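/- Let A ⊆ ℕ^n be a finite set and suppose r = ℝ₊·x^γ is an extreme ray of the SONC cone C(A) such that there is no circuit (S, β) on A with |S| > 1, γ ∈ S, and β even. Then r is an exposed face of C(A); that is, there exists a linear functional l on the space of polynomials supported on A with l(x^γ) = 0 and l(g) > 0 for all g ∈ C(A) \ r. -/

import Mathlib

open MvPolynomial Finset

/-- A lattice exponent is even if every entry is even. -/
def IsEvenPt {n : ℕ} (α : Fin n →₀ ℕ) : Prop := ∀ i, Even (α i)

/-- The embedding of a lattice exponent into `ℝⁿ`. -/
def toR {n : ℕ} (α : Fin n →₀ ℕ) : Fin n → ℝ := fun i => (α i : ℝ)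

/-- `(S, β)` is a (simplicial) circuit on the ground set `A`:
`S ⊆ A ∩ (2ℕ)ⁿ` is affinely independent and `β ∈ A` lies in the relative
interior of `conv S`. -/
structure IsCircuitOn {n : ℕ} (A : Finset (Fin n →₀ ℕ)) (S : Finset (Fin n →₀ ℕ))
    (β : Fin n →₀ ℕ) : Prop where
  subset : S ⊆ A
  even_mem : ∀ α ∈ S, IsEvenPt α
  beta_mem : β ∈ A
  indep : AffineIndependent ℝ (fun α : S => toR (α : Fin n →₀ ℕ))
  relint : toR β ∈ intrinsicInterior ℝ (convexHull ℝ (toR '' (S : Set (Fin n →₀ ℕ))))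

/-- `lam` gives the barycentric coordinates of `β` with respect to `S`. -/
def IsBarycentric {n : ℕ} (S : Finset (Fin n →₀ ℕ)) (β : Fin n →₀ ℕ)
    (lam : (Fin n →₀ ℕ) → ℝ) : Prop :=
  (∀ α ∈ S, 0 < lam α) ∧ ∑ α ∈ S, lam α = 1 ∧
    ∀ i, (β i : ℝ) = ∑ α ∈ S, lam α * (α i : ℝ)

/-- The circuit number `Θ = ∏_{α ∈ S} (c_α / λ_α) ^ (λ_α)`. -/
noncomputable def circuitNumber {n : ℕ} (S : Finset (Fin n →₀ ℕ))
    (c lam : (Fin n →₀ ℕ) → ℝ) : ℝ :=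
  ∏ α ∈ S, (c α / lam α) ^ (lam α)

/-- The circuit polynomial `∑_{α ∈ S} c_α x^α + d x^β`. -/
noncomputable def circuitPoly {n : ℕ} (S : Finset (Fin n →₀ ℕ)) (β : Fin n →₀ ℕ)
    (c : (Fin n →₀ ℕ) → ℝ) (d : ℝ) : MvPolynomial (Fin n) ℝ :=
  (∑ α ∈ S, monomial α (c α)) + monomial β d

/-- Generators of the SONC cone on `A`: nonnegative circuit polynomials on circuits
on `A`, together with monomial squares `x^α`, `α ∈ A ∩ (2ℕ)ⁿ`. -/
def SONCGen {n : ℕ} (A : Finset (Fin n →₀ ℕ)) : Set (MvPolynomial (Fin n) ℝ) :=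
  {f | (∃ S β c d, IsCircuitOn A S β ∧ (∀ α ∈ S, 0 < c α) ∧
          f = circuitPoly S β c d ∧ ∀ x : Fin n → ℝ, 0 ≤ eval x f) ∨
       (∃ α ∈ A, IsEvenPt α ∧ f = monomial α 1)}

/-- The SONC cone on `A`: all finite nonnegative combinations of the generators. -/
def SONCCone {n : ℕ} (A : Finset (Fin n →₀ ℕ)) : Set (MvPolynomial (Fin n) ℝ) :=
  {f | ∃ (k : ℕ) (g : Fin k → MvPolynomial (Fin n) ℝ) (μ : Fin k → ℝ),
        (∀ i, g i ∈ SONCGen A ∧ 0 ≤ μ i) ∧ f = ∑ i, μ i • g i}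

/-- The ray `ℝ₊ · f`. -/
def raySet {n : ℕ} (f : MvPolynomial (Fin n) ℝ) : Set (MvPolynomial (Fin n) ℝ) :=
  {p | ∃ t : ℝ, 0 ≤ t ∧ p = t • f}

/-- `ℝ₊ · f` is an extreme ray of the convex cone `K`. -/
def IsExtremeRay {n : ℕ} (K : Set (MvPolynomial (Fin n) ℝ))
    (f : MvPolynomial (Fin n) ℝ) : Prop :=
  f ≠ 0 ∧ f ∈ K ∧ ∀ g h, g ∈ K → h ∈ K → f = g + h → g ∈ raySet f ∧ h ∈ raySet f

/-- The ray `ℝ₊ · f` is an exposed face of `K`: some linear functional vanishes on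
the ray and is strictly positive on the rest of `K`. -/
def IsExposedRay {n : ℕ} (K : Set (MvPolynomial (Fin n) ℝ))
    (f : MvPolynomial (Fin n) ℝ) : Prop :=
  ∃ l : MvPolynomial (Fin n) ℝ →ₗ[ℝ] ℝ,
    (∀ p ∈ raySet f, l p = 0) ∧ ∀ g ∈ K \ raySet f, 0 < l g

/-- `(S, β)` is a reduced circuit on `A`: the only even points of `A` in `conv S`
are those of `S ∪ {β}`. -/
def IsReducedCircuitOn {n : ℕ} (A : Finset (Fin n →₀ ℕ)) (S : Finset (Fin n →₀ ℕ))
    (β : Fin n →₀ ℕ) : Prop :=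
  IsCircuitOn A S β ∧
    {γ : Fin n →₀ ℕ | γ ∈ A ∧ IsEvenPt γ ∧
        toR γ ∈ convexHull ℝ (toR '' (S : Set (Fin n →₀ ℕ)))} =
      {γ : Fin n →₀ ℕ | (γ ∈ S ∨ γ = β) ∧ IsEvenPt γ}

/-- The symmetric integer interval `{-N, …, N}`, viewed in `ℝ`. -/
noncomputable def symmetricInterval (N : ℕ) : Finset ℝ :=
  (Finset.Icc (-(N : ℤ)) N).image (Int.cast : ℤ → ℝ)

/-- The sum of the values of a polynomial over the grid `{-N, …, N}ⁿ`. -/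
noncomputable def gridSum (n N : ℕ) : MvPolynomial (Fin n) ℝ →ₗ[ℝ] ℝ :=
  ∑ x ∈ Fintype.piFinset fun _ : Fin n => symmetricInterval N, (aeval x).toLinearMap

theorem card_symmetricInterval (N : ℕ) : #(symmetricInterval N) = 2 * N + 1 := by
  rw [symmetricInterval, Finset.card_image_of_injective _ Int.cast_injective, Int.card_Icc]
  omega

theorem neg_mem_symmetricInterval {N : ℕ} {t : ℝ} (ht : t ∈ symmetricInterval N) :
    -t ∈ symmetricInterval N := by
  simp only [symmetricInterval, Finset.mem_image, Finset.mem_Icc] at ht ⊢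
  obtain ⟨k, ⟨h₁, h₂⟩, rfl⟩ := ht
  exact ⟨-k, ⟨by omega, by omega⟩, by simp⟩

theorem gridSum_apply {n : ℕ} (N : ℕ) (f : MvPolynomial (Fin n) ℝ) :
    gridSum n N f = ∑ x ∈ Fintype.piFinset fun _ : Fin n => symmetricInterval N, eval x f := by
  simp [gridSum, LinearMap.sum_apply, aeval_eq_eval]

theorem sum_symmetricInterval_pow_of_odd (N : ℕ) {k : ℕ} (hk : Odd k) :
    ∑ t ∈ symmetricInterval N, t ^ k = 0 := by
  have h : ∑ t ∈ symmetricInterval N, t ^ k = ∑ t ∈ symmetricInterval N, (-t) ^ k :=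
    Finset.sum_bij' (fun t _ => -t) (fun t _ => -t)
      (fun _ => neg_mem_symmetricInterval) (fun _ => neg_mem_symmetricInterval)
      (by simp) (by simp) (by simp)
  simp only [hk.neg_pow, Finset.sum_neg_distrib] at h
  linarith

theorem gridSum_monomial {n : ℕ} (N : ℕ) (α : Fin n →₀ ℕ) (c : ℝ) :
    gridSum n N (monomial α c) = c * ∏ i, ∑ t ∈ symmetricInterval N, t ^ α i := by
  rw [gridSum_apply, Finset.prod_univ_sum, Finset.mul_sum]
  refine Finset.sum_congr rfl fun x _ => ?_
  rw [eval_monomial, Finsupp.prod_fintype _ _ (by simp)]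

theorem gridSum_monomial_of_not_isEvenPt {n : ℕ} (N : ℕ) {α : Fin n →₀ ℕ} (hα : ¬ IsEvenPt α)
    (c : ℝ) : gridSum n N (monomial α c) = 0 := by
  obtain ⟨i, hi⟩ := not_forall.mp hα
  rw [gridSum_monomial, Finset.prod_eq_zero (Finset.mem_univ i)
    (sum_symmetricInterval_pow_of_odd N (Nat.not_even_iff_odd.mp hi)), mul_zero]

theorem gridSum_monomial_pos {n N : ℕ} (hN : 1 ≤ N) {α : Fin n →₀ ℕ} (hα : IsEvenPt α)
    {c : ℝ} (hc : 0 < c) : 0 < gridSum n N (monomial α c) := by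
  rw [gridSum_monomial]
  refine mul_pos hc (Finset.prod_pos fun i _ => ?_)
  refine Finset.sum_pos' (fun t _ => (hα i).pow_nonneg t) ⟨1, ?_, by simp⟩
  exact Finset.mem_image.mpr ⟨1, Finset.mem_Icc.mpr ⟨by omega, by omega⟩, by simp⟩

theorem gridSum_pos {n N : ℕ} {f : MvPolynomial (Fin n) ℝ} (hdeg : ∀ i, degreeOf i f ≤ N)
    (hf : ∀ x, 0 ≤ eval x f) (h0 : f ≠ 0) : 0 < gridSum n N f := by
  rw [gridSum_apply]
  refine (Finset.sum_nonneg fun x _ => hf x).lt_of_ne fun h => h0 ?_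
  refine eq_zero_of_eval_zero_at_prod_finset f (fun _ => symmetricInterval N) (fun i => ?_) ?_
  · rw [card_symmetricInterval]
    have := hdeg i
    omega
  · intro x hx
    exact (Finset.sum_eq_zero_iff_of_nonneg fun y _ => hf y).mp h.symm x
      (Fintype.mem_piFinset.mpr hx)

theorem degreeOf_circuitPoly_le {n : ℕ} {A S : Finset (Fin n →₀ ℕ)} {β : Fin n →₀ ℕ}
    (h : IsCircuitOn A S β) {N : ℕ} (hN : ∀ α ∈ A, ∀ i, α i ≤ N) (c : (Fin n →₀ ℕ) → ℝ) (d : ℝ)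
    (i : Fin n) : degreeOf i (circuitPoly S β c d) ≤ N := by
  have hmon : ∀ α ∈ A, ∀ e : ℝ, degreeOf i (monomial α e) ≤ N := by
    intro α hα e
    by_cases he : e = 0
    · simp [he]
    · rw [degreeOf_monomial_eq _ _ he]
      exact hN α hα i
  refine (degreeOf_add_le _ _ _).trans (max_le ?_ (hmon β h.beta_mem d))
  exact (degreeOf_sum_le _ _ _).trans (Finset.sup_le fun α hα => hmon α (h.subset hα) _)

theorem toR_injective {n : ℕ} : Function.Injective (toR (n := n)) := fun _ _ h =>
  Finsupp.ext fun i => Nat.cast_injective (R := ℝ) (congrFun h i)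

theorem IsCircuitOn.toR_mem_convexHull {n : ℕ} {A S : Finset (Fin n →₀ ℕ)} {β : Fin n →₀ ℕ}
    (h : IsCircuitOn A S β) :
    toR β ∈ convexHull ℝ (toR '' (S : Set (Fin n →₀ ℕ))) :=
  intrinsicInterior_subset h.relint

theorem IsCircuitOn.nonempty {n : ℕ} {A S : Finset (Fin n →₀ ℕ)} {β : Fin n →₀ ℕ}
    (h : IsCircuitOn A S β) : S.Nonempty := by
  have := convexHull_nonempty_iff.mp ⟨_, h.toR_mem_convexHull⟩
  simpa using this

theorem IsCircuitOn.eq_of_singleton {n : ℕ} {A : Finset (Fin n →₀ ℕ)} {α β : Fin n →₀ ℕ}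
    (h : IsCircuitOn A {α} β) : β = α := by
  have := h.toR_mem_convexHull
  simp only [Finset.coe_singleton, Set.image_singleton, convexHull_singleton,
    Set.mem_singleton_iff] at this
  exact toR_injective this

/-- The sum of values over the grid, with the coefficient of `x^γ` disregarded. -/
noncomputable def gridSumErase {n : ℕ} (N : ℕ) (γ : Fin n →₀ ℕ) :
    MvPolynomial (Fin n) ℝ →ₗ[ℝ] ℝ :=
  gridSum n N - gridSum n N (monomial γ 1) • lcoeff ℝ γ

theorem gridSumErase_apply {n : ℕ} (N : ℕ) (γ : Fin n →₀ ℕ) (f : MvPolynomial (Fin n) ℝ) :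
    gridSumErase N γ f = gridSum n N f - gridSum n N (monomial γ 1) * coeff γ f := by
  simp [gridSumErase]

theorem gridSumErase_monomial_self {n : ℕ} (N : ℕ) (γ : Fin n →₀ ℕ) (c : ℝ) :
    gridSumErase N γ (monomial γ c) = 0 := by
  simp [gridSumErase_apply, gridSum_monomial, mul_comm]

theorem gridSumErase_monomial_of_ne {n : ℕ} (N : ℕ) {α γ : Fin n →₀ ℕ} (h : α ≠ γ) (c : ℝ) :
    gridSumErase N γ (monomial α c) = gridSum n N (monomial α c) := by
  simp [gridSumErase_apply, coeff_monomial, h]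

theorem gridSumErase_circuitPoly_pos {n N : ℕ} (hN : 1 ≤ N) {A S : Finset (Fin n →₀ ℕ)}
    {β γ : Fin n →₀ ℕ} (hS : IsCircuitOn A S β) {c : (Fin n →₀ ℕ) → ℝ} (hc : ∀ α ∈ S, 0 < c α)
    (d : ℝ) (hβ : gridSumErase N γ (monomial β d) = 0) (hγ : ∃ α ∈ S, α ≠ γ) :
    0 < gridSumErase N γ (circuitPoly S β c d) := by
  have hpos : ∀ α ∈ S, α ≠ γ → 0 < gridSumErase N γ (monomial α (c α)) := fun α hα hne => by
    rw [gridSumErase_monomial_of_ne N hne]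
    exact gridSum_monomial_pos hN (hS.even_mem α hα) (hc α hα)
  rw [circuitPoly, map_add, map_sum, hβ, add_zero]
  refine Finset.sum_pos' (fun α hα => ?_) ?_
  · rcases eq_or_ne α γ with rfl | hne
    · rw [gridSumErase_monomial_self]
    · exact (hpos α hα hne).le
  · obtain ⟨α, hα, hne⟩ := hγ
    exact ⟨α, hα, hpos α hα hne⟩

theorem zero_mem_raySet {n : ℕ} (f : MvPolynomial (Fin n) ℝ) : 0 ∈ raySet f :=
  ⟨0, le_rfl, by simp⟩

theorem sum_smul_mem_raySet {n : ℕ} {f : MvPolynomial (Fin n) ℝ} {ι : Type*} {s : Finset ι}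
    {g : ι → MvPolynomial (Fin n) ℝ} (hg : ∀ i ∈ s, g i ∈ raySet f) :
    ∑ i ∈ s, g i ∈ raySet f := by
  refine Finset.sum_induction g (· ∈ raySet f) ?_ (zero_mem_raySet f) hg
  rintro _ _ ⟨s, hs, rfl⟩ ⟨t, ht, rfl⟩
  exact ⟨s + t, add_nonneg hs ht, (add_smul s t f).symm⟩

/-- A functional exposes a ray of the SONC cone as soon as it does so on generators. -/
theorem isExposedRay_of_generators {n : ℕ} {A : Finset (Fin n →₀ ℕ)}
    {f : MvPolynomial (Fin n) ℝ} (l : MvPolynomial (Fin n) ℝ →ₗ[ℝ] ℝ) (hf : l f = 0)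
    (hgen : ∀ g ∈ SONCGen A, g ∈ raySet f ∨ 0 < l g) : IsExposedRay (SONCCone A) f := by
  have hray : ∀ p ∈ raySet f, l p = 0 := by
    rintro _ ⟨t, -, rfl⟩
    simp [hf]
  refine ⟨l, hray, ?_⟩
  rintro _ ⟨⟨k, g, μ, hg, rfl⟩, hnot⟩
  have hdich : ∀ i, μ i • g i ∈ raySet f ∨ 0 < l (μ i • g i) := by
    intro i
    obtain ⟨hgi, hμ⟩ := hg i
    rcases hμ.eq_or_lt with h0 | hpos
    · left
      rw [← h0, zero_smul]
      exact zero_mem_raySet f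
    · refine (hgen _ hgi).imp ?_ fun h => ?_
      · rintro ⟨t, ht, h⟩
        exact ⟨μ i * t, mul_nonneg hμ ht, by rw [h, mul_smul]⟩
      · rw [map_smul, smul_eq_mul]
        exact mul_pos hpos h
  rw [map_sum]
  refine Finset.sum_pos' (fun i _ => ?_) ?_
  · exact (hdich i).elim (fun h => (hray _ h).ge) le_of_lt
  · by_contra! h
    exact hnot <| sum_smul_mem_raySet fun i hi => (hdich i).resolve_right (h i hi).not_gt

theorem gridSumErase_pos_of_mem_SONCGen {n N : ℕ} {A : Finset (Fin n →₀ ℕ)} {γ : Fin n →₀ ℕ}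
    (hN : 1 ≤ N) (hA : ∀ α ∈ A, ∀ i, α i ≤ N)
    (hno : ¬ ∃ (S : Finset (Fin n →₀ ℕ)) (β : Fin n →₀ ℕ),
        IsCircuitOn A S β ∧ 1 < S.card ∧ γ ∈ S ∧ IsEvenPt β)
    {g : MvPolynomial (Fin n) ℝ} (hg : g ∈ SONCGen A) :
    g ∈ raySet (monomial γ (1 : ℝ)) ∨ 0 < gridSumErase N γ g := by
  rcases hg with ⟨S, β, c, d, hS, hc, rfl, hnn⟩ | ⟨α, -, hα, rfl⟩
  · by_cases hγ : γ ∈ S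
    · rcases Nat.eq_or_lt_of_le hS.nonempty.card_pos with h1 | h1
      · obtain ⟨α, rfl⟩ := Finset.card_eq_one.mp h1.symm
        obtain rfl := Finset.mem_singleton.mp hγ
        obtain rfl := hS.eq_of_singleton
        refine Or.inl ⟨c β + d, ?_, ?_⟩
        · simpa [circuitPoly, eval_monomial] using hnn 1
        · simp [circuitPoly, smul_monomial]
      · have hβ : ¬ IsEvenPt β := fun h => hno ⟨S, β, hS, h1, hγ, h⟩
        have hne : β ≠ γ := fun h => hβ (h ▸ hS.even_mem γ hγ)
        refine Or.inr (gridSumErase_circuitPoly_pos hN hS hc d ?_ ?_)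
        · rw [gridSumErase_monomial_of_ne N hne, gridSum_monomial_of_not_isEvenPt N hβ]
        · exact Finset.exists_mem_ne h1 γ
    · by_cases hβ : β = γ
      · subst hβ
        obtain ⟨α, hα⟩ := hS.nonempty
        exact Or.inr <| gridSumErase_circuitPoly_pos hN hS hc d (gridSumErase_monomial_self N β d)
          ⟨α, hα, ne_of_mem_of_not_mem hα hγ⟩
      · by_cases h0 : circuitPoly S β c d = 0
        · exact Or.inl (h0 ▸ zero_mem_raySet _)
        · right
          have hcoeff : coeff γ (circuitPoly S β c d) = 0 := by
            simp [circuitPoly, coeff_sum, coeff_monomial, hγ, hβ]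
          rw [gridSumErase_apply, hcoeff, mul_zero, sub_zero]
          exact gridSum_pos (degreeOf_circuitPoly_le hS hA c d) hnn h0
  · rcases eq_or_ne α γ with rfl | hne
    · exact Or.inl ⟨1, zero_le_one, (one_smul _ _).symm⟩
    · right
      rw [gridSumErase_monomial_of_ne N hne]
      exact gridSum_monomial_pos hN hα one_pos

/-- **Exposedness of the remaining monomial extreme rays.** If `ℝ₊ · x^γ` is an
extreme ray of the SONC cone and there is no circuit `(S, β)` on `A` with `|S| > 1`,
`γ ∈ S` and `β` even, then the ray is exposed. -/
theorem monomial_ray_exposed {n : ℕ} (A : Finset (Fin n →₀ ℕ)) (γ : Fin n →₀ ℕ)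
    (hext : IsExtremeRay (SONCCone A) ((monomial γ (1 : ℝ) : MvPolynomial (Fin n) ℝ)))
    (hno : ¬ ∃ (S : Finset (Fin n →₀ ℕ)) (β : Fin n →₀ ℕ),
        IsCircuitOn A S β ∧ 1 < S.card ∧ γ ∈ S ∧ IsEvenPt β) :
    IsExposedRay (SONCCone A) ((monomial γ (1 : ℝ) : MvPolynomial (Fin n) ℝ)) := by
  obtain ⟨N, hN, hA⟩ : ∃ N, 1 ≤ N ∧ ∀ α ∈ A, ∀ i, α i ≤ N :=
    ⟨A.sup Finsupp.degree + 1, by omega, fun α hα i =>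
      ((Finsupp.le_degree i α).trans (Finset.le_sup hα)).trans (Nat.le_succ _)⟩
  exact isExposedRay_of_generators (gridSumErase N γ) (gridSumErase_monomial_self N γ 1)
    fun g => gridSumErase_pos_of_mem_SONCGen hN hA hno
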